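/- arXiv:1805.01734 — 3 statements merged into one kernel-verified Lean document; each statement's English description precedes it below -/
import Mathlib

section
/- Let n be a positive integer, let α ∈ (0,1), and let ω > 0. Then ∫₀^∞ e^{−x} x^{n−1} (ω+x)^{−(n+α)} dx = − ( π Γ(1−n−α) / sin(πα) ) Σ_{j=0}^{∞} (−1)^j ω^{j} / ( j! Γ(1−n−α−j) Γ(j+α+1) ) + (−1)^n (n−1)! e^{ω} ω^{−α} Σ_{r=0}^{∞} (−1)^r Γ(1−α−n+r) ω^{r} / ( r! Γ(1−α+r) ), both series converging absolutely. -/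
open MeasureTheory Filter Real Topology

lemma hasSum_exp_neg (x : ℝ) :
    HasSum (fun r : ℕ => (-1 : ℝ) ^ r / r.factorial * x ^ r) (Real.exp (-x)) := by
  have h := NormedSpace.expSeries_div_hasSum_exp (-x)
  rw [← Real.exp_eq_exp_ℝ] at h
  refine h.congr_fun fun r => ?_
  rw [neg_pow]; ring

/-- The power series of the lower incomplete Gamma function. -/
lemma hasSum_lowerGamma {s ω : ℝ} (hs : 0 < s) (hω : 0 < ω) :
    HasSum (fun r : ℕ => (-1 : ℝ) ^ r / r.factorial * (ω ^ (r + s) / (r + s)))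
      (∫ x in Set.Ioc 0 ω, Real.exp (-x) * x ^ (s - 1)) := by
  have hint (r : ℕ) : IntegrableOn (fun x : ℝ => x ^ (r + s - 1)) (Set.Ioc 0 ω) := by
    rw [← intervalIntegrable_iff_integrableOn_Ioc_of_le hω.le]
    exact intervalIntegral.intervalIntegrable_rpow' (by have : (0 : ℝ) ≤ r := r.cast_nonneg; linarith)
  have hval (r : ℕ) : ∫ x in Set.Ioc 0 ω, x ^ (r + s - 1) = ω ^ (r + s) / (r + s) := by
    have hr : (0 : ℝ) ≤ r := r.cast_nonneg
    rw [← intervalIntegral.integral_of_le hω.le, integral_rpow (Or.inl (by linarith))]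
    rw [sub_add_cancel, Real.zero_rpow (by positivity), sub_zero]
  have key := hasSum_integral_of_summable_integral_norm
    (μ := volume.restrict (Set.Ioc 0 ω))
    (F := fun (r : ℕ) x => (-1 : ℝ) ^ r / r.factorial * x ^ (r + s - 1))
    (fun r => (hint r).const_mul _) ?_
  · simp_rw [integral_const_mul, hval] at key
    rwa [setIntegral_congr_fun (g := fun x => Real.exp (-x) * x ^ (s - 1)) measurableSet_Ioc
      fun x hx => ?_] at key
    simp only
    rw [← ((hasSum_exp_neg x).mul_right (x ^ (s - 1))).tsum_eq]
    refine tsum_congr fun r => ?_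
    rw [add_sub_assoc, Real.rpow_add hx.1, Real.rpow_natCast]; ring
  · have hn (r : ℕ) : ∫ x in Set.Ioc 0 ω, ‖(-1 : ℝ) ^ r / r.factorial * x ^ (r + s - 1)‖ =
        1 / r.factorial * (ω ^ (r + s) / (r + s)) := by
      rw [← hval, ← integral_const_mul]
      refine setIntegral_congr_fun measurableSet_Ioc fun x hx => ?_
      have := Real.rpow_nonneg hx.1.le (r + s - 1)
      simp [abs_of_nonneg this]
    simp_rw [hn]
    refine ((Real.summable_pow_div_factorial ω).mul_right (ω ^ s / s)).of_nonneg_of_le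
      (fun r => by positivity) fun r => ?_
    rw [Real.rpow_add hω, Real.rpow_natCast]
    calc 1 / (r.factorial : ℝ) * (ω ^ r * ω ^ s / (r + s))
        ≤ 1 / (r.factorial : ℝ) * (ω ^ r * ω ^ s / s) := by gcongr; simp
      _ = _ := by ring

/-- The integrand of the generalized Stieltjes integral representation of `U(N + 1, 1 - α, ω)`. -/
noncomputable def stieltjesIntegrand (N : ℕ) (α ω x : ℝ) : ℝ :=
  Real.exp (-x) * x ^ N * (ω + x) ^ (-((N : ℝ) + 1 + α))

lemma stieltjesIntegrand_succ {ω x : ℝ} (N : ℕ) (α : ℝ) (h : 0 < ω + x) :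
    stieltjesIntegrand (N + 1) α ω x =
      stieltjesIntegrand N α ω x - ω * stieltjesIntegrand N (α + 1) ω x := by
  have e : (ω + x) ^ (-((N : ℝ) + 1 + α)) = (ω + x) ^ (-((N : ℝ) + 1 + (α + 1))) * (ω + x) := by
    rw [← Real.rpow_add_one h.ne']; ring_nf
  have e' : -(((N + 1 : ℕ) : ℝ) + 1 + α) = -((N : ℝ) + 1 + (α + 1)) := by push_cast; ring
  simp only [stieltjesIntegrand]
  rw [e, e']; ring

lemma isBigO_exp_neg_mul_rpow_add (p ω : ℝ) :
    (fun x => Real.exp (-x) * (ω + x) ^ p) =O[atTop] fun x => Real.exp (-(1 / 2) * x) := by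
  have h := (isLittleO_rpow_exp_pos_mul_atTop p (b := 1 / 2) (by norm_num)).isBigO.comp_tendsto
    (tendsto_atTop_add_const_left atTop ω tendsto_id)
  have h2 := (Asymptotics.isBigO_refl (fun x : ℝ => Real.exp (-x)) atTop).mul h
  refine h2.trans ?_
  refine Asymptotics.IsBigO.of_bound (Real.exp (ω / 2)) (Eventually.of_forall fun x => ?_)
  simp only [Function.comp, Real.norm_eq_abs, ← Real.exp_add, Real.abs_exp, id]
  apply le_of_eq; ring_nf

lemma integrableOn_stieltjesIntegrand {ω : ℝ} (hω : 0 < ω) (N : ℕ) (α : ℝ) :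
    IntegrableOn (stieltjesIntegrand N α ω) (Set.Ioi 0) := by
  induction N generalizing α with
  | zero =>
    have : stieltjesIntegrand 0 α ω = fun x => Real.exp (-x) * (ω + x) ^ (-(1 + α)) := by
      ext x; simp [stieltjesIntegrand]
    rw [this]
    refine integrable_of_isBigO_exp_neg (b := 1 / 2) (by norm_num) ?_
      (isBigO_exp_neg_mul_rpow_add _ _)
    refine ContinuousOn.mul (by fun_prop) (ContinuousOn.rpow_const (by fun_prop) fun x hx => ?_)
    have : 0 ≤ x := hx
    left; positivity
  | succ N ih =>
    refine ((ih α).sub ((ih (α + 1)).const_mul ω)).congr_fun (fun x hx => ?_) measurableSet_Ioi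
    have : 0 < x := hx
    exact (stieltjesIntegrand_succ N α (by positivity)).symm

/-- The generalized Stieltjes integral, equal to `N! ω ^ (-α) U(N + 1, 1 - α, ω)`. -/
noncomputable def stieltjesIntegral (N : ℕ) (α ω : ℝ) : ℝ :=
  ∫ x in Set.Ioi (0 : ℝ), stieltjesIntegrand N α ω x

lemma stieltjesIntegral_succ {ω : ℝ} (hω : 0 < ω) (N : ℕ) (α : ℝ) :
    stieltjesIntegral (N + 1) α ω =
      stieltjesIntegral N α ω - ω * stieltjesIntegral N (α + 1) ω := by
  simp only [stieltjesIntegral]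
  rw [← integral_const_mul, ← integral_sub (integrableOn_stieltjesIntegrand hω N α)
    ((integrableOn_stieltjesIntegrand hω N (α + 1)).const_mul ω)]
  refine setIntegral_congr_fun measurableSet_Ioi fun x hx => ?_
  have : 0 < x := hx
  exact stieltjesIntegrand_succ N α (by positivity)

lemma stieltjesIntegral_zero_add_one {ω : ℝ} (hω : 0 < ω) (α : ℝ) :
    stieltjesIntegral 0 α ω = ω ^ (-(α + 1)) - (α + 1) * stieltjesIntegral 0 (α + 1) ω := by
  have hd : ∀ x ∈ Set.Ici (0 : ℝ), HasDerivAt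
      (fun x => Real.exp (-x) * (ω + x) ^ (-(α + 1)))
      (-stieltjesIntegrand 0 α ω x - (α + 1) * stieltjesIntegrand 0 (α + 1) ω x) x := by
    intro x hx
    have hx0 : 0 ≤ x := hx
    have h1 : HasDerivAt (fun x : ℝ => Real.exp (-x)) (-Real.exp (-x)) x := by
      simpa using (hasDerivAt_neg x).exp
    have h2 : HasDerivAt (fun x : ℝ => ω + x) 1 x := by
      simpa using (hasDerivAt_id x).const_add ω
    refine (h1.mul (h2.rpow_const (p := -(α + 1)) (Or.inl (by positivity)))).congr_deriv ?_
    simp only [stieltjesIntegrand]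
    push_cast
    rw [show -(α + 1) - 1 = -(0 + 1 + (α + 1)) by ring, show -(α + 1) = -(0 + 1 + α) by ring]
    ring
  have hi := (integrableOn_stieltjesIntegrand hω 0 α).neg.sub
    ((integrableOn_stieltjesIntegrand hω 0 (α + 1)).const_mul (α + 1))
  have hlim : Tendsto (fun x => Real.exp (-x) * (ω + x) ^ (-(α + 1))) atTop (𝓝 0) := by
    refine (isBigO_exp_neg_mul_rpow_add _ _).trans_tendsto ?_
    refine Real.tendsto_exp_atBot.comp ?_
    exact tendsto_id.const_mul_atTop_of_neg (by norm_num)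
  have h := integral_Ioi_of_hasDerivAt_of_tendsto' hd hi hlim
  have h' : ∫ x in Set.Ioi (0 : ℝ),
      (-stieltjesIntegrand 0 α ω x - (α + 1) * stieltjesIntegrand 0 (α + 1) ω x) =
      -stieltjesIntegral 0 α ω - (α + 1) * stieltjesIntegral 0 (α + 1) ω := by
    refine (integral_sub (integrableOn_stieltjesIntegrand hω 0 α).neg
      ((integrableOn_stieltjesIntegrand hω 0 (α + 1)).const_mul (α + 1))).trans ?_
    rw [integral_const_mul]
    congr 1
    exact integral_neg _
  rw [h'] at h
  simp only [neg_zero, Real.exp_zero, add_zero, one_mul, zero_sub] at h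
  linarith

lemma stieltjesIntegral_zero_neg {s ω : ℝ} (hs : 0 < s) (hω : 0 < ω) :
    Real.Gamma s = (∫ x in Set.Ioc 0 ω, Real.exp (-x) * x ^ (s - 1)) +
      Real.exp (-ω) * stieltjesIntegral 0 (-s) ω := by
  have hc := Real.GammaIntegral_convergent hs
  rw [Real.Gamma_eq_integral hs, ← Set.Ioc_union_Ioi_eq_Ioi hω.le,
    setIntegral_union (Set.Ioc_disjoint_Ioi le_rfl) measurableSet_Ioi
      (hc.mono_set Set.Ioc_subset_Ioi_self) (hc.mono_set (Set.Ioi_subset_Ioi hω.le)),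
    ← (measurePreserving_add_left volume ω).setIntegral_preimage_emb
      (measurableEmbedding_addLeft ω) _ (Set.Ioi ω), stieltjesIntegral, ← integral_const_mul]
  congr 1
  simp only [Set.preimage_const_add_Ioi, sub_self]
  refine setIntegral_congr_fun measurableSet_Ioi fun x _ => ?_
  simp only [stieltjesIntegrand, neg_add, Real.exp_add]
  push_cast
  ring_nf

lemma hasSum_stieltjesIntegral_zero {ω : ℝ} (hω : 0 < ω) (k : ℕ) {α : ℝ} (hk : α < k)
    (hα : ∀ m : ℤ, α ≠ m) :
    HasSum (fun r : ℕ => (-1 : ℝ) ^ r * ω ^ r / (r.factorial * (r - α)))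
      (ω ^ α * (Real.Gamma (-α) - Real.exp (-ω) * stieltjesIntegral 0 α ω)) := by
  induction k generalizing α with
  | zero =>
    have hs : 0 < -α := by simpa using hk
    have h := (hasSum_lowerGamma hs hω).mul_left (ω ^ α)
    rw [stieltjesIntegral_zero_neg hs hω, neg_neg, add_sub_cancel_right]
    refine h.congr_fun fun r => ?_
    rw [Real.rpow_add hω, Real.rpow_neg hω.le, Real.rpow_natCast]
    have := (Real.rpow_pos_of_pos hω α).ne'
    have h3 : (r : ℝ) - α ≠ 0 := sub_ne_zero.2 fun h => hα r (by simp [h])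
    rw [← sub_eq_add_neg]
    field_simp
  | succ k ih =>
    obtain ⟨β, rfl⟩ : ∃ β, α = β + 1 := ⟨α - 1, by ring⟩
    have hβ : ∀ m : ℤ, β ≠ m := fun m h => hα (m + 1) (by simp [h])
    have h := ih (by push_cast at hk; linarith) hβ
    have h0 : β + 1 ≠ 0 := by simpa using hα 0
    have hshift : HasSum (fun r : ℕ => (r : ℝ) * ((-1) ^ r / r.factorial * ω ^ r) / (r - (β + 1)))
        (-ω * (ω ^ β * (Real.Gamma (-β) - Real.exp (-ω) * stieltjesIntegral 0 β ω))) := by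
      refine (hasSum_nat_add_iff' 1).1 ?_
      simp only [Finset.range_one, Finset.sum_singleton, Nat.cast_zero, zero_mul, zero_div,
        sub_zero]
      refine (h.mul_left (-ω)).congr_fun fun r => ?_
      have h3 : (r : ℝ) - β ≠ 0 := sub_ne_zero.2 fun h => hβ r (by simp [h])
      rw [Nat.factorial_succ]
      push_cast
      rw [show (r : ℝ) + 1 - (β + 1) = r - β by ring]
      field_simp
      ring
    have hG : Real.Gamma (-β) = -(β + 1) * Real.Gamma (-(β + 1)) := by
      rw [← Real.Gamma_add_one (neg_ne_zero.2 h0)]; ring_nf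
    have hpow : ω ^ (-(β + 1)) * ω ^ (β + 1) = 1 := by
      rw [← Real.rpow_add hω]; simp
    have hval : (-(β + 1))⁻¹ * (Real.exp (-ω) -
        -ω * (ω ^ β * (Real.Gamma (-β) - Real.exp (-ω) * stieltjesIntegral 0 β ω))) =
        ω ^ (β + 1) * (Real.Gamma (-(β + 1)) -
          Real.exp (-ω) * stieltjesIntegral 0 (β + 1) ω) := by
      rw [stieltjesIntegral_zero_add_one hω, hG, inv_mul_eq_iff_eq_mul₀ (neg_ne_zero.2 h0)]
      rw [Real.rpow_add_one hω.ne' β] at hpow ⊢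
      linear_combination (-Real.exp (-ω)) * hpow
    rw [← hval]
    refine (((hasSum_exp_neg ω).sub hshift).mul_left (-(β + 1))⁻¹).congr_fun fun r => ?_
    have h3 : (r : ℝ) - (β + 1) ≠ 0 := sub_ne_zero.2 fun h => hα r (by simp [h])
    field_simp
    ring

/-- The terms of the power series of `₁F₁(N + 1 + α; 1 + α; ω) / Γ(1 + α)`. -/
noncomputable def kummerTerm (N : ℕ) (α ω : ℝ) (j : ℕ) : ℝ :=
  Real.Gamma (N + 1 + α + j) / (Real.Gamma (N + 1 + α) * j.factorial * Real.Gamma (1 + α + j)) *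
    ω ^ j

/-- The regularized Kummer function `₁F₁(N + 1 + α; 1 + α; ω) / Γ(1 + α)`. -/
noncomputable def kummerSeries (N : ℕ) (α ω : ℝ) : ℝ := ∑' j, kummerTerm N α ω j

lemma kummerTerm_succ_zero {α : ℝ} (hα : 0 < α) (N : ℕ) (ω : ℝ) :
    kummerTerm (N + 1) α ω 0 = kummerTerm N α ω 0 := by
  have h1 := (Real.Gamma_pos_of_pos (show 0 < (N : ℝ) + 1 + α by positivity)).ne'
  have h2 := (Real.Gamma_pos_of_pos (show 0 < (N : ℝ) + 1 + 1 + α by positivity)).ne'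
  simp only [kummerTerm]
  push_cast
  simp only [add_zero]
  field_simp

lemma kummerTerm_succ_succ {α : ℝ} (hα : 0 < α) (N : ℕ) (ω : ℝ) (j : ℕ) :
    kummerTerm (N + 1) α ω (j + 1) =
      kummerTerm N α ω (j + 1) + ω * kummerTerm N (α + 1) ω j := by
  have p1 : 0 < (N : ℝ) + 1 + α := by positivity
  have p2 : 0 < (N : ℝ) + 1 + α + (j + 1) := by positivity
  have h1 := (Real.Gamma_pos_of_pos p1).ne'
  have h2 := (Real.Gamma_pos_of_pos p2).ne'
  have h3 := (Real.Gamma_pos_of_pos (show 0 < 1 + α + ((j : ℝ) + 1) by positivity)).ne'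
  have e1 : Real.Gamma ((N : ℝ) + 1 + 1 + α) = (N + 1 + α) * Real.Gamma (N + 1 + α) := by
    rw [← Real.Gamma_add_one p1.ne']; ring_nf
  have e2 : Real.Gamma ((N : ℝ) + 1 + 1 + α + (j + 1)) =
      (N + 1 + α + (j + 1)) * Real.Gamma (N + 1 + α + (j + 1)) := by
    rw [← Real.Gamma_add_one p2.ne']; ring_nf
  simp only [kummerTerm, Nat.factorial_succ]
  push_cast
  rw [show (N : ℝ) + 1 + (α + 1) = N + 1 + 1 + α by ring,
    show (N : ℝ) + 1 + 1 + α + j = N + 1 + α + (j + 1) by ring,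
    show 1 + (α + 1) + (j : ℝ) = 1 + α + (j + 1) by ring, e1, e2]
  field_simp
  ring

lemma hasSum_kummerTerm_zero {α : ℝ} (hα : 0 < α) (ω : ℝ) :
    HasSum (kummerTerm 0 α ω) (Real.exp ω / Real.Gamma (1 + α)) := by
  have h := NormedSpace.expSeries_div_hasSum_exp ω
  rw [← Real.exp_eq_exp_ℝ] at h
  refine (h.div_const _).congr_fun fun j => ?_
  have h1 := (Real.Gamma_pos_of_pos (show 0 < 1 + α + (j : ℝ) by positivity)).ne'
  simp only [kummerTerm]
  push_cast
  rw [zero_add]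
  field_simp

lemma summable_kummerTerm {α : ℝ} (hα : 0 < α) (N : ℕ) (ω : ℝ) :
    Summable (kummerTerm N α ω) := by
  induction N generalizing α with
  | zero => exact (hasSum_kummerTerm_zero hα ω).summable
  | succ N ih =>
    rw [← summable_nat_add_iff 1]
    simp_rw [kummerTerm_succ_succ hα]
    exact ((summable_nat_add_iff 1).2 (ih hα)).add ((ih (by positivity)).mul_left ω)

lemma kummerSeries_succ {α : ℝ} (hα : 0 < α) (N : ℕ) (ω : ℝ) :
    kummerSeries (N + 1) α ω = kummerSeries N α ω + ω * kummerSeries N (α + 1) ω := by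
  have h1 := summable_kummerTerm hα N ω
  have h2 := summable_kummerTerm (show 0 < α + 1 by positivity) N ω
  simp only [kummerSeries]
  rw [(summable_kummerTerm hα (N + 1) ω).tsum_eq_zero_add, h1.tsum_eq_zero_add]
  simp_rw [kummerTerm_succ_succ hα, kummerTerm_succ_zero hα]
  rw [((summable_nat_add_iff 1).2 h1).tsum_add (h2.mul_left ω), tsum_mul_left, add_assoc]

lemma Gamma_neg_sub_mul_Gamma {x : ℝ} (hx : ∀ m : ℤ, x ≠ m) (j : ℕ) :
    Real.Gamma (-x - j) * Real.Gamma (1 + x + j) =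
      (-1) ^ j * (Real.Gamma (-x) * Real.Gamma (1 + x)) := by
  induction j with
  | zero => simp
  | succ j ih =>
    have h1 : -x - ((j : ℝ) + 1) ≠ 0 := fun h => hx (-(j + 1)) (by push_cast; linarith)
    have h2 : 1 + x + (j : ℝ) ≠ 0 := fun h => hx (-(j + 1)) (by push_cast; linarith)
    have e1 := Real.Gamma_add_one h1
    have e2 := Real.Gamma_add_one h2
    rw [show -x - ((j : ℝ) + 1) + 1 = -x - j by ring] at e1
    push_cast
    rw [pow_succ, show 1 + x + ((j : ℝ) + 1) = 1 + x + j + 1 by ring, e2]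
    rw [e1] at ih
    linear_combination -ih

lemma Gamma_ne_zero_of_ne_int {x : ℝ} (hx : ∀ m : ℤ, x ≠ m) : Real.Gamma x ≠ 0 :=
  Real.Gamma_ne_zero fun m => by simpa using hx (-m)

lemma hasSum_stieltjesIntegral {ω : ℝ} (hω : 0 < ω) (N : ℕ) {α : ℝ} (hα0 : 0 < α)
    (hα : ∀ m : ℤ, α ≠ m) :
    HasSum (fun r : ℕ => (-1 : ℝ) ^ r * Real.Gamma (-α - N + r) * ω ^ r /
        (r.factorial * Real.Gamma (1 - α + r)))
      ((-1) ^ (N + 1) * Real.exp (-ω) * ω ^ α / N.factorial *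
        (stieltjesIntegral N α ω -
          Real.Gamma (-α) * Real.Gamma (1 + α) * kummerSeries N α ω)) := by
  induction N generalizing α with
  | zero =>
    obtain ⟨k, hk⟩ := exists_nat_gt α
    have h := hasSum_stieltjesIntegral_zero hω k hk hα
    have hE : Real.exp (-ω) * Real.exp ω = 1 := by rw [← Real.exp_add]; simp
    have hG := (Real.Gamma_pos_of_pos (show 0 < 1 + α by positivity)).ne'
    have hval : (-1) ^ (0 + 1) * Real.exp (-ω) * ω ^ α / (Nat.factorial 0) *
        (stieltjesIntegral 0 α ω -
          Real.Gamma (-α) * Real.Gamma (1 + α) * kummerSeries 0 α ω) =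
        ω ^ α * (Real.Gamma (-α) - Real.exp (-ω) * stieltjesIntegral 0 α ω) := by
      rw [kummerSeries, (hasSum_kummerTerm_zero hα0 ω).tsum_eq, mul_assoc (Real.Gamma (-α)),
        mul_div_cancel₀ _ hG]
      simp only [Nat.factorial_zero, Nat.cast_one]
      linear_combination ω ^ α * Real.Gamma (-α) * hE
    rw [hval]
    refine h.congr_fun fun r => ?_
    have h3 : (r : ℝ) - α ≠ 0 := sub_ne_zero.2 fun h => hα r (by simp [h])
    have h4 : Real.Gamma (r - α) ≠ 0 := Gamma_ne_zero_of_ne_int fun m h =>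
      hα (r - m) (by push_cast; linarith)
    have e := Real.Gamma_add_one h3
    push_cast
    rw [show 1 - α + (r : ℝ) = r - α + 1 by ring, e, show -α - 0 + (r : ℝ) = r - α by ring]
    field_simp
  | succ N ih =>
    have hα1 : ∀ m : ℤ, α + 1 ≠ m := fun m h => hα (m - 1) (by push_cast; linarith)
    have h := ((ih hα0 hα).sub (ih (by positivity) hα1)).mul_left (-((N : ℝ) + 1)⁻¹)
    have hc := Gamma_neg_sub_mul_Gamma hα 1
    rw [Nat.cast_one, pow_one, show -α - 1 = -(α + 1) by ring,
      show 1 + α + 1 = 1 + (α + 1) by ring] at hc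
    have hval : (-1) ^ (N + 1 + 1) * Real.exp (-ω) * ω ^ α / (N + 1).factorial *
        (stieltjesIntegral (N + 1) α ω -
          Real.Gamma (-α) * Real.Gamma (1 + α) * kummerSeries (N + 1) α ω) =
        -((N : ℝ) + 1)⁻¹ * ((-1) ^ (N + 1) * Real.exp (-ω) * ω ^ α / N.factorial *
          (stieltjesIntegral N α ω -
            Real.Gamma (-α) * Real.Gamma (1 + α) * kummerSeries N α ω) -
          (-1) ^ (N + 1) * Real.exp (-ω) * ω ^ (α + 1) / N.factorial *
          (stieltjesIntegral N (α + 1) ω -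
            Real.Gamma (-(α + 1)) * Real.Gamma (1 + (α + 1)) * kummerSeries N (α + 1) ω)) := by
      rw [hc, stieltjesIntegral_succ hω, kummerSeries_succ hα0, Real.rpow_add_one hω.ne',
        Nat.factorial_succ]
      push_cast
      field_simp
      ring
    rw [hval]
    refine h.congr_fun fun r => ?_
    have n1 : -α - ((N : ℝ) + 1) + r ≠ 0 := fun h => hα (r - (N + 1)) (by push_cast; linarith)
    have n2 : -α + (r : ℝ) ≠ 0 := fun h => hα r (by push_cast; linarith)
    have n3 : Real.Gamma (-α + r) ≠ 0 := Gamma_ne_zero_of_ne_int fun m h =>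
      hα (r - m) (by push_cast; linarith)
    have e1 := Real.Gamma_add_one n1
    have e2 := Real.Gamma_add_one n2
    push_cast
    rw [show -α - (N : ℝ) + r = -α - ((N : ℝ) + 1) + r + 1 by ring,
      show 1 - α + (r : ℝ) = -α + r + 1 by ring,
      show 1 - (α + 1) + (r : ℝ) = -α + r by ring,
      show -(α + 1) - (N : ℝ) + r = -α - (N + 1) + r by ring, e1, e2]
    field_simp
    ring

/-- exact expansion, by finite-part integration, of the
generalized Stieltjes integral representation of the Kummer function
`U(n, 1-α, ω)` (up to the factor `(n-1)! ω^{-α}`). -/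
theorem stmt_11 (n : ℕ) (hn : 1 ≤ n) (α : ℝ) (hα : α ∈ Set.Ioo (0 : ℝ) 1)
    (ω : ℝ) (hω : 0 < ω) :
    Summable (fun j : ℕ => (-1 : ℝ) ^ j * ω ^ j /
      (Nat.factorial j * Real.Gamma (1 - (n : ℝ) - α - j) *
        Real.Gamma ((j : ℝ) + α + 1))) ∧
    Summable (fun r : ℕ => (-1 : ℝ) ^ r * Real.Gamma (1 - α - (n : ℝ) + r) *
      ω ^ r / (Nat.factorial r * Real.Gamma (1 - α + r))) ∧
    (∫ x in Set.Ioi (0 : ℝ), Real.exp (-x) * x ^ (n - 1) *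
        (ω + x) ^ (-((n : ℝ) + α))) =
      -(Real.pi * Real.Gamma (1 - (n : ℝ) - α) / Real.sin (Real.pi * α)) *
        (∑' j : ℕ, (-1 : ℝ) ^ j * ω ^ j /
          (Nat.factorial j * Real.Gamma (1 - (n : ℝ) - α - j) *
            Real.Gamma ((j : ℝ) + α + 1))) +
      (-1 : ℝ) ^ n * Nat.factorial (n - 1) * Real.exp ω * ω ^ (-α) *
        ∑' r : ℕ, (-1 : ℝ) ^ r * Real.Gamma (1 - α - (n : ℝ) + r) * ω ^ r /
          (Nat.factorial r * Real.Gamma (1 - α + r)) := by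
  obtain ⟨N, rfl⟩ : ∃ N, n = N + 1 := ⟨n - 1, by omega⟩
  have hαZ : ∀ m : ℤ, α ≠ m := by
    rintro m rfl
    have h1 : (0 : ℤ) < m := by exact_mod_cast hα.1
    have h2 : m < (1 : ℤ) := by exact_mod_cast hα.2
    omega
  have hα0 := hα.1
  have hB := hasSum_stieltjesIntegral hω N hα0 hαZ
  have hB' : (fun r : ℕ => (-1 : ℝ) ^ r * Real.Gamma (1 - α - ((N + 1 : ℕ) : ℝ) + r) *
      ω ^ r / (Nat.factorial r * Real.Gamma (1 - α + r))) =
      fun r : ℕ => (-1 : ℝ) ^ r * Real.Gamma (-α - N + r) * ω ^ r /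
        (r.factorial * Real.Gamma (1 - α + r)) := by
    ext r; push_cast; ring_nf
  have hx : ∀ m : ℤ, (N : ℝ) + α ≠ m := fun m h => hαZ (m - N) (by push_cast; linarith)
  have hG : Real.Gamma (1 - ((N + 1 : ℕ) : ℝ) - α) ≠ 0 := Gamma_ne_zero_of_ne_int fun m h =>
    hαZ (-N - m) (by push_cast at h ⊢; linarith)
  have hA : (fun j : ℕ => (-1 : ℝ) ^ j * ω ^ j /
      (Nat.factorial j * Real.Gamma (1 - ((N + 1 : ℕ) : ℝ) - α - j) *
        Real.Gamma ((j : ℝ) + α + 1))) =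
      fun j : ℕ => (Real.Gamma (1 - ((N + 1 : ℕ) : ℝ) - α))⁻¹ * kummerTerm N α ω j := by
    ext j
    have h := Gamma_neg_sub_mul_Gamma hx j
    rw [show -((N : ℝ) + α) = 1 - ((N + 1 : ℕ) : ℝ) - α by push_cast; ring,
      show 1 + ((N : ℝ) + α) = N + 1 + α by ring] at h
    have h1 := (Real.Gamma_pos_of_pos (show 0 < (N : ℝ) + 1 + α by positivity)).ne'
    have h2 := (Real.Gamma_pos_of_pos (show 0 < 1 + α + (j : ℝ) by positivity)).ne'
    have h3 : Real.Gamma (1 - ((N + 1 : ℕ) : ℝ) - α - j) ≠ 0 := Gamma_ne_zero_of_ne_int fun m h =>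
      hαZ (-N - j - m) (by push_cast at h ⊢; linarith)
    rw [kummerTerm, show (j : ℝ) + α + 1 = 1 + α + j by ring]
    generalize Real.Gamma (1 - ((N + 1 : ℕ) : ℝ) - α) = a at *
    generalize Real.Gamma (1 - ((N + 1 : ℕ) : ℝ) - α - j) = b at *
    field_simp
    linear_combination -h
  have hint : (∫ x in Set.Ioi (0 : ℝ), Real.exp (-x) * x ^ (N + 1 - 1) *
        (ω + x) ^ (-(((N + 1 : ℕ) : ℝ) + α))) = stieltjesIntegral N α ω := by
    simp [stieltjesIntegral, stieltjesIntegrand]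
  have hrefl : Real.Gamma (-α) * Real.Gamma (1 + α) = -(Real.pi / Real.sin (Real.pi * α)) := by
    have h := Real.Gamma_mul_Gamma_one_sub (-α)
    rwa [sub_neg_eq_add, mul_neg, Real.sin_neg, div_neg] at h
  rw [hA, hB', hint]
  refine ⟨(summable_kummerTerm hα0 N ω).mul_left _, hB.summable, ?_⟩
  rw [tsum_mul_left, hB.tsum_eq, hrefl, ← kummerSeries]
  have hE : Real.exp ω * Real.exp (-ω) = 1 := by rw [← Real.exp_add]; simp
  have hW : ω ^ (-α) * ω ^ α = 1 := by rw [← Real.rpow_add hω]; simp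
  have hS : ((-1 : ℝ) ^ (N + 1)) * (-1) ^ (N + 1) = 1 := by rw [← mul_pow]; simp
  have hF : (N.factorial : ℝ) * (N.factorial : ℝ)⁻¹ = 1 :=
    mul_inv_cancel₀ (by exact_mod_cast N.factorial_ne_zero)
  have hGG := mul_inv_cancel₀ hG
  rw [Nat.add_sub_cancel]
  generalize Real.Gamma (1 - ((N + 1 : ℕ) : ℝ) - α) = g at *
  set D := stieltjesIntegral N α ω -
    -(Real.pi / Real.sin (Real.pi * α)) * kummerSeries N α ω with hD
  calc stieltjesIntegral N α ω
      = -(Real.pi / Real.sin (Real.pi * α)) * (g * g⁻¹) * kummerSeries N α ω +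
        (((-1 : ℝ) ^ (N + 1)) * (-1) ^ (N + 1)) * ((N.factorial : ℝ) * (N.factorial : ℝ)⁻¹) *
          (Real.exp ω * Real.exp (-ω)) * (ω ^ (-α) * ω ^ α) * D := by
        rw [hGG, hS, hF, hE, hW, hD]; ring
    _ = _ := by ring
end

section
/- Let n be a positive integer and let α ∈ (0,1). Then lim_{ω→0⁺} ω^{α} ∫₀^∞ e^{−x} x^{n−1} (ω+x)^{−(n+α)} dx = Γ(n) Γ(α) / Γ(n+α). -/
open MeasureTheory Filter Real Topology

lemma pow_mul_one_add_rpow_le (m : ℕ) (α : ℝ) {t : ℝ} (ht : 0 < t) :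
    t ^ m * (1 + t) ^ (-((m : ℝ) + 1 + α)) ≤ (t + 1) ^ (-(1 + α)) := by
  have h : (1 + t) ^ (-(1 + α)) = (1 + t) ^ m * (1 + t) ^ (-((m : ℝ) + 1 + α)) := by
    rw [← Real.rpow_natCast, ← Real.rpow_add (by positivity)]
    ring_nf
  rw [add_comm t 1, h]
  gcongr
  linarith

lemma integrableOn_pow_mul_one_add_rpow (m : ℕ) {α : ℝ} (hα : 0 < α) :
    IntegrableOn (fun t : ℝ => t ^ m * (1 + t) ^ (-((m : ℝ) + 1 + α))) (Set.Ioi 0) := by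
  refine Integrable.mono' (integrableOn_add_rpow_Ioi_of_lt (a := -(1 + α)) (m := 1)
    (by linarith) (by norm_num)) (by fun_prop) ?_
  filter_upwards [ae_restrict_mem measurableSet_Ioi] with t (ht : 0 < t)
  rw [Real.norm_of_nonneg (by positivity)]
  exact pow_mul_one_add_rpow_le m α ht

lemma hasDerivAt_one_add_rpow (p : ℝ) {t : ℝ} (ht : 0 ≤ t) :
    HasDerivAt (fun t : ℝ => (1 + t) ^ p) (p * (1 + t) ^ (p - 1)) t := by
  simpa using ((hasDerivAt_id t).const_add 1).rpow_const (p := p)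
    (Or.inl (by simp only [id]; positivity))

lemma tendsto_one_add_rpow_neg {α : ℝ} (hα : 0 < α) :
    Tendsto (fun t : ℝ => (1 + t) ^ (-α)) atTop (𝓝 0) :=
  (tendsto_rpow_neg_atTop hα).comp (tendsto_atTop_add_const_left _ 1 tendsto_id)

lemma integral_pow_succ_mul_one_add_rpow (m : ℕ) {α : ℝ} (hα : 0 < α) :
    ((m : ℝ) + 1 + α) *
        ∫ t in Set.Ioi (0 : ℝ), t ^ (m + 1) * (1 + t) ^ (-(((m + 1 : ℕ) : ℝ) + 1 + α)) =
      ((m : ℝ) + 1) * ∫ t in Set.Ioi (0 : ℝ), t ^ m * (1 + t) ^ (-((m : ℝ) + 1 + α)) := by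
  have h₀ := (integrableOn_pow_mul_one_add_rpow m hα).const_mul ((m : ℝ) + 1)
  have h₁ := (integrableOn_pow_mul_one_add_rpow (m + 1) hα).const_mul ((m : ℝ) + 1 + α)
  have hderiv : ∀ t ∈ Set.Ici (0 : ℝ),
      HasDerivAt (fun t : ℝ => t ^ (m + 1) * (1 + t) ^ (-((m : ℝ) + 1 + α)))
        (((m : ℝ) + 1) * (t ^ m * (1 + t) ^ (-((m : ℝ) + 1 + α))) -
          ((m : ℝ) + 1 + α) *
            (t ^ (m + 1) * (1 + t) ^ (-(((m + 1 : ℕ) : ℝ) + 1 + α)))) t := by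
    intro t ht
    refine ((hasDerivAt_pow (m + 1) t).mul
      (hasDerivAt_one_add_rpow (-((m : ℝ) + 1 + α)) ht)).congr_deriv ?_
    rw [show -(((m + 1 : ℕ) : ℝ) + 1 + α) = -((m : ℝ) + 1 + α) - 1 by push_cast; ring]
    push_cast
    ring
  have hlim : Tendsto (fun t : ℝ => t ^ (m + 1) * (1 + t) ^ (-((m : ℝ) + 1 + α)))
      atTop (𝓝 0) := by
    refine squeeze_zero' ?_ ?_ (tendsto_one_add_rpow_neg hα)
    · filter_upwards [eventually_gt_atTop 0] with t ht
      positivity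
    · filter_upwards [eventually_gt_atTop 0] with t ht
      have h := pow_mul_one_add_rpow_le (m + 1) (α - 1) ht
      rw [add_comm t 1] at h
      convert h using 3
      · push_cast; ring
      · ring
  have h := integral_Ioi_of_hasDerivAt_of_tendsto' hderiv (h₀.sub h₁) hlim
  rw [integral_sub h₀ h₁, integral_const_mul, integral_const_mul] at h
  simp only [ne_eq, Nat.add_eq_zero_iff, one_ne_zero, and_false, not_false_eq_true, zero_pow,
    zero_mul, sub_zero] at h
  linarith

lemma integral_pow_mul_one_add_rpow (m : ℕ) {α : ℝ} (hα : 0 < α) :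
    ∫ t in Set.Ioi (0 : ℝ), t ^ m * (1 + t) ^ (-((m : ℝ) + 1 + α)) =
      Real.Gamma ((m : ℝ) + 1) * Real.Gamma α / Real.Gamma ((m : ℝ) + 1 + α) := by
  induction m with
  | zero =>
    have hderiv : ∀ t ∈ Set.Ici (0 : ℝ), HasDerivAt (fun t : ℝ => -α⁻¹ * (1 + t) ^ (-α))
        (t ^ 0 * (1 + t) ^ (-(((0 : ℕ) : ℝ) + 1 + α))) t := by
      intro t ht
      refine ((hasDerivAt_one_add_rpow (-α) ht).const_mul (-α⁻¹)).congr_deriv ?_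
      rw [show -(((0 : ℕ) : ℝ) + 1 + α) = -α - 1 by push_cast; ring]
      field_simp
    rw [integral_Ioi_of_hasDerivAt_of_tendsto' hderiv (integrableOn_pow_mul_one_add_rpow 0 hα)
      ((tendsto_one_add_rpow_neg hα).const_mul _)]
    have := (Real.Gamma_pos_of_pos hα).ne'
    simp only [Nat.cast_zero, zero_add, add_comm 1 α, Real.Gamma_add_one hα.ne', Real.Gamma_one,
      add_zero, Real.one_rpow]
    field_simp
    ring
  | succ m ih =>
    have h := integral_pow_succ_mul_one_add_rpow m hα
    have hs : (m : ℝ) + 1 + α ≠ 0 := by positivity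
    have hG : Real.Gamma ((m : ℝ) + 1 + α) ≠ 0 := (Real.Gamma_pos_of_pos (by positivity)).ne'
    rw [ih] at h
    refine mul_left_cancel₀ hs (h.trans ?_)
    rw [show ((m + 1 : ℕ) : ℝ) + 1 + α = ((m : ℝ) + 1 + α) + 1 by push_cast; ring,
      Real.Gamma_add_one hs, Nat.cast_succ, Real.Gamma_add_one (s := (m : ℝ) + 1) (by positivity)]
    field_simp

lemma rpow_mul_stieltjes_integral_eq (m : ℕ) (α : ℝ) {ω : ℝ} (hω : 0 < ω) :
    ω ^ α * ∫ x in Set.Ioi (0 : ℝ), Real.exp (-x) * x ^ m * (ω + x) ^ (-((m : ℝ) + 1 + α)) =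
      ∫ t in Set.Ioi (0 : ℝ),
        Real.exp (-(ω * t)) * (t ^ m * (1 + t) ^ (-((m : ℝ) + 1 + α))) := by
  have h := integral_comp_mul_left_Ioi
    (fun x : ℝ => Real.exp (-x) * x ^ m * (ω + x) ^ (-((m : ℝ) + 1 + α))) 0 hω
  rw [mul_zero, smul_eq_mul, eq_inv_mul_iff_mul_eq₀ hω.ne'] at h
  rw [← h, ← mul_assoc, ← integral_const_mul]
  refine setIntegral_congr_fun measurableSet_Ioi fun t (ht : 0 < t) => ?_
  have hpow : ω ^ α * ω * ω ^ m * ω ^ (-((m : ℝ) + 1 + α)) = 1 := by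
    rw [← Real.rpow_natCast, ← Real.rpow_add_one hω.ne', ← Real.rpow_add hω,
      ← Real.rpow_add hω]
    ring_nf
    exact Real.rpow_zero ω
  rw [show ω + ω * t = ω * (1 + t) by ring, Real.mul_rpow hω.le (by positivity), mul_pow]
  linear_combination Real.exp (-(ω * t)) * (t ^ m * (1 + t) ^ (-((m : ℝ) + 1 + α))) * hpow

/-- dominant small-`ω` behavior of the generalized Stieltjes
transform of `e^{-x} x^{n-1}` of order `n + α`. -/
theorem stmt_12 (n : ℕ) (hn : 1 ≤ n) (α : ℝ) (hα : α ∈ Set.Ioo (0 : ℝ) 1) :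
    Tendsto (fun ω : ℝ => ω ^ α *
        ∫ x in Set.Ioi (0 : ℝ), Real.exp (-x) * x ^ (n - 1) *
          (ω + x) ^ (-((n : ℝ) + α)))
      (nhdsWithin 0 (Set.Ioi 0))
      (nhds (Real.Gamma (n : ℝ) * Real.Gamma α / Real.Gamma ((n : ℝ) + α))) := by
  obtain ⟨m, rfl⟩ := Nat.exists_eq_add_of_le' hn
  simp only [Nat.add_sub_cancel, Nat.cast_add, Nat.cast_one]
  rw [← integral_pow_mul_one_add_rpow m hα.1]
  refine Tendsto.congr' (f₁ := fun ω : ℝ => ∫ t in Set.Ioi (0 : ℝ),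
    Real.exp (-(ω * t)) * (t ^ m * (1 + t) ^ (-((m : ℝ) + 1 + α)))) ?_ ?_
  · filter_upwards [self_mem_nhdsWithin] with ω hω
    exact (rpow_mul_stieltjes_integral_eq m α hω).symm
  refine tendsto_integral_filter_of_dominated_convergence _ ?_ ?_
    (integrableOn_pow_mul_one_add_rpow m hα.1) ?_
  · exact Eventually.of_forall fun ω => by fun_prop
  · filter_upwards [self_mem_nhdsWithin] with ω (hω : 0 < ω)
    filter_upwards [ae_restrict_mem measurableSet_Ioi] with t (ht : 0 < t)
    rw [Real.norm_of_nonneg (by positivity)]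
    refine mul_le_of_le_one_left (by positivity) (Real.exp_le_one_iff.mpr ?_)
    have := mul_pos hω ht
    linarith
  · refine Eventually.of_forall fun t => ?_
    have hcont : Continuous fun ω : ℝ =>
        Real.exp (-(ω * t)) * (t ^ m * (1 + t) ^ (-((m : ℝ) + 1 + α))) := by fun_prop
    simpa using (hcont.tendsto 0).mono_left nhdsWithin_le_nhds
end

section
/- Let α > 0 and let β be a real number. Then lim_{ω→0⁺} ( ∫₀^∞ e^{−α x² + β x} / √(ω²+x²) dx + ln ω ) = −(1/2) ( ln(α/4) + γ ) + (1/2) Σ_{m=1}^{∞} Γ(m/2) β^{m} / ( m! α^{m/2} ), where γ is the Euler–Mascheroni constant and the series converges absolutely. -/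
open MeasureTheory Filter Real Topology

lemma integrable_exp_neg_mul_sq_add_mul {a : ℝ} (ha : 0 < a) (b : ℝ) :
    Integrable fun x : ℝ => exp (-a * x ^ 2 + b * x) := by
  have h := (integrable_cexp_quadratic (b := (a : ℂ)) (by simpa using ha) b 0).norm
  refine h.congr (ae_of_all _ fun x => ?_)
  simp only [Complex.norm_exp]
  congr 1
  simp [← Complex.ofReal_pow]

/-- The logarithmic moment of the exponential distribution. -/
lemma integral_exp_neg_mul_log :
    ∫ t in Set.Ioi (0 : ℝ), exp (-t) * log t = -eulerMascheroniConstant := by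
  have h1 : HasDerivAt Complex.Gamma
      (∫ t : ℝ in Set.Ioi 0, (t : ℂ) ^ ((1 : ℂ) - 1) * (log t * exp (-t))) 1 := by
    refine (Complex.hasDerivAt_GammaIntegral (s := 1) (by simp)).congr_of_eventuallyEq ?_
    have : ∀ᶠ s : ℂ in 𝓝 1, 0 < s.re :=
      Complex.continuous_re.continuousAt.eventually_const_lt (by simp)
    filter_upwards [this] with s hs using Complex.Gamma_eq_integral hs
  have h2 := h1.unique Complex.hasDerivAt_Gamma_one
  have h3 : (∫ t : ℝ in Set.Ioi 0, (t : ℂ) ^ ((1 : ℂ) - 1) * (log t * exp (-t)))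
      = ((∫ t in Set.Ioi (0 : ℝ), exp (-t) * log t : ℝ) : ℂ) := by
    rw [← integral_complex_ofReal]
    refine integral_congr_ae (ae_of_all _ fun t => ?_)
    simp [mul_comm]
  rw [h3] at h2
  exact_mod_cast h2

lemma abs_exp_sub_one_le_mul_exp (y : ℝ) : |exp y - 1| ≤ |y| * exp |y| := by
  rcases le_total 0 y with hy | hy
  · have h1 := add_one_le_exp (-y)
    have h2 : exp (-y) * exp y = 1 := by rw [← exp_add]; simp
    rw [abs_of_nonneg (sub_nonneg.2 (one_le_exp hy)), abs_of_nonneg hy]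
    nlinarith [exp_pos y]
  · have h1 := add_one_le_exp y
    have h2 : 1 ≤ exp (-y) := one_le_exp (by linarith)
    rw [abs_of_nonpos (sub_nonpos.2 (exp_le_one_iff.2 hy)), abs_of_nonpos hy]
    nlinarith

lemma abs_log_add_sqrt_le {w x : ℝ} (hw : 0 ≤ w) (hw1 : w ≤ 1) (hx : 0 < x) :
    |log (x + √(w ^ 2 + x ^ 2))| ≤ 2 * x + 1 / (2 * x) := by
  have hl : x ≤ √(w ^ 2 + x ^ 2) := le_sqrt_of_sq_le (by nlinarith)
  have hu : √(w ^ 2 + x ^ 2) ≤ w + x := sqrt_le_iff.2 ⟨by positivity, by nlinarith⟩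
  have h1 := log_le_sub_one_of_pos (x := x + √(w ^ 2 + x ^ 2)) (by positivity)
  have h2 := log_le_log (show 0 < 2 * x by positivity)
    (show 2 * x ≤ x + √(w ^ 2 + x ^ 2) by linarith)
  have h3 := one_sub_inv_le_log_of_pos (show 0 < 2 * x by positivity)
  have h4 : 0 < (2 * x)⁻¹ := by positivity
  rw [one_div, abs_le]
  constructor <;> linarith

lemma integrableOn_quadratic_mul_exp_neg_mul_sq {a : ℝ} (ha : 0 < a) :
    IntegrableOn (fun x : ℝ => (4 * a * x ^ 2 + a) * exp (-a * x ^ 2)) (Set.Ioi 0) := by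
  have h0 := (integrable_exp_neg_mul_sq ha).const_mul a
  have h2 := (integrable_rpow_mul_exp_neg_mul_sq ha (s := 2) (by norm_num)).const_mul (4 * a)
  refine ((h2.add h0).congr (ae_of_all _ fun x => ?_)).integrableOn
  simp only [rpow_two, Pi.add_apply]
  ring

lemma norm_mul_exp_mul_log_le {a w x : ℝ} (ha : 0 < a) (hw : 0 ≤ w) (hw1 : w ≤ 1) (hx : 0 < x) :
    ‖2 * a * x * exp (-a * x ^ 2) * log (x + √(w ^ 2 + x ^ 2))‖ ≤
      (4 * a * x ^ 2 + a) * exp (-a * x ^ 2) := by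
  rw [norm_mul, norm_of_nonneg (by positivity : 0 ≤ 2 * a * x * exp (-a * x ^ 2)), norm_eq_abs]
  refine (mul_le_mul_of_nonneg_left (abs_log_add_sqrt_le hw hw1 hx) (by positivity)).trans
    (le_of_eq ?_)
  field_simp
  ring

lemma aestronglyMeasurable_mul_exp_mul_log (a w : ℝ) (μ : Measure ℝ) :
    AEStronglyMeasurable
      (fun x : ℝ => 2 * a * x * exp (-a * x ^ 2) * log (x + √(w ^ 2 + x ^ 2))) μ :=
  (by fun_prop : Measurable
    (fun x : ℝ => 2 * a * x * exp (-a * x ^ 2) * log (x + √(w ^ 2 + x ^ 2)))).aestronglyMeasurable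

lemma integrableOn_mul_exp_mul_log {a w : ℝ} (ha : 0 < a) (hw : 0 ≤ w) (hw1 : w ≤ 1) :
    IntegrableOn (fun x : ℝ => 2 * a * x * exp (-a * x ^ 2) * log (x + √(w ^ 2 + x ^ 2)))
      (Set.Ioi 0) :=
  (integrableOn_quadratic_mul_exp_neg_mul_sq ha).mono'
    (aestronglyMeasurable_mul_exp_mul_log a w _)
    ((ae_restrict_iff' measurableSet_Ioi).2
      (ae_of_all _ fun _ hx => norm_mul_exp_mul_log_le ha hw hw1 hx))

lemma integrable_exp_div_sqrt {a w : ℝ} (ha : 0 < a) (hw : 0 < w) :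
    Integrable (fun x : ℝ => exp (-a * x ^ 2) / √(w ^ 2 + x ^ 2)) := by
  refine ((integrable_exp_neg_mul_sq ha).mul_const w⁻¹).mono'
    (by fun_prop : Measurable _).aestronglyMeasurable (ae_of_all _ fun x => ?_)
  have : w ≤ √(w ^ 2 + x ^ 2) := le_sqrt_of_sq_le (by nlinarith [sq_nonneg x])
  rw [norm_of_nonneg (by positivity), div_eq_mul_inv]
  gcongr

lemma integral_exp_div_sqrt {a w : ℝ} (ha : 0 < a) (hw : 0 < w) (hw1 : w ≤ 1) :
    ∫ x in Set.Ioi (0 : ℝ), exp (-a * x ^ 2) / √(w ^ 2 + x ^ 2) =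
      -log w + ∫ x in Set.Ioi (0 : ℝ),
        2 * a * x * exp (-a * x ^ 2) * log (x + √(w ^ 2 + x ^ 2)) := by
  have hpos (x : ℝ) : 0 < w ^ 2 + x ^ 2 := by positivity
  have hu (x : ℝ) : HasDerivAt (fun x : ℝ => exp (-a * x ^ 2))
      (-(2 * a * x * exp (-a * x ^ 2))) x := by
    convert! (((hasDerivAt_id x).pow 2).const_mul (-a)).exp using 1
    simp
    ring
  have hv (x : ℝ) (hx : x ∈ Set.Ioi 0) : HasDerivAt (fun x : ℝ => log (x + √(w ^ 2 + x ^ 2)))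
      (√(w ^ 2 + x ^ 2))⁻¹ x := by
    have hx : 0 < x := hx
    have hs : 0 < √(w ^ 2 + x ^ 2) := sqrt_pos.2 (hpos x)
    convert! ((hasDerivAt_id x).add
      ((((hasDerivAt_id x).pow 2).const_add (w ^ 2)).sqrt (hpos x).ne')).log
        (by simp; positivity) using 1
    simp
    field_simp
    ring
  have h_zero : Tendsto (fun x : ℝ => exp (-a * x ^ 2) * log (x + √(w ^ 2 + x ^ 2)))
      (𝓝[>] 0) (𝓝 (log w)) := by
    have : ContinuousAt (fun x : ℝ => exp (-a * x ^ 2) * log (x + √(w ^ 2 + x ^ 2))) 0 := by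
      have h0 : (0 : ℝ) + √(w ^ 2 + 0 ^ 2) ≠ 0 := by
        have := sqrt_pos.2 (hpos 0); positivity
      fun_prop (disch := assumption)
    have h := this.tendsto
    have h0 : exp (-a * 0 ^ 2) * log (0 + √(w ^ 2 + 0 ^ 2)) = log w := by simp [sqrt_sq hw.le]
    rw [h0] at h
    exact h.mono_left nhdsWithin_le_nhds
  have h_infty : Tendsto (fun x : ℝ => exp (-a * x ^ 2) * log (x + √(w ^ 2 + x ^ 2)))
      atTop (𝓝 0) := by
    have h := ((rpow_mul_exp_neg_mul_sq_isLittleO_exp_neg ha 1).tendsto_zero_of_tendsto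
      (tendsto_exp_atBot.comp <| tendsto_id.const_mul_atTop_of_neg
        (by norm_num : -(1 / 2 : ℝ) < 0))).const_mul 3
    rw [mul_zero] at h
    refine squeeze_zero_norm' ?_ h
    filter_upwards [eventually_ge_atTop 1] with x hx
    have hx0 : 0 < x := by linarith
    have h1 := abs_log_add_sqrt_le hw.le hw1 hx0
    have h2 : 1 / (2 * x) ≤ x := by rw [div_le_iff₀ (by positivity)]; nlinarith
    rw [norm_mul, norm_of_nonneg (exp_pos _).le, norm_eq_abs, rpow_one]
    nlinarith [exp_pos (-a * x ^ 2)]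
  have key := integral_Ioi_mul_deriv_eq_deriv_mul (fun x _ => hu x) hv
    (by simpa [Pi.mul_def, div_eq_mul_inv] using (integrable_exp_div_sqrt ha hw).integrableOn)
    (by simpa [Pi.mul_def] using (integrableOn_mul_exp_mul_log ha hw.le hw1).neg)
    h_zero h_infty
  simp only [← div_eq_mul_inv, neg_mul, integral_neg] at key ⊢
  rw [key]
  ring

lemma integral_mul_exp_mul_log_two_mul {a : ℝ} (ha : 0 < a) :
    ∫ x in Set.Ioi (0 : ℝ), 2 * a * x * exp (-a * x ^ 2) * log (x + √(0 ^ 2 + x ^ 2)) =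
      -(1 / 2) * (log (a / 4) + eulerMascheroniConstant) := by
  have hsubst (g : ℝ → ℝ) : ∫ x in Set.Ioi (0 : ℝ), 2 * a * x * g (a * x ^ 2) =
      ∫ t in Set.Ioi (0 : ℝ), g t := by
    have h1 := integral_comp_rpow_Ioi_of_pos (g := fun y => a * g (a * y)) two_pos
    have h2 := integral_comp_mul_left_Ioi' g 0 ha
    rw [mul_zero] at h2
    rw [← h2, smul_eq_mul, ← integral_const_mul, ← h1]
    refine setIntegral_congr_fun measurableSet_Ioi fun x _ => ?_
    norm_num
    ring
  have hone := hsubst fun t => exp (-t)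
  have hlog := hsubst fun t => exp (-t) * log t
  rw [integral_exp_neg_Ioi_zero] at hone
  rw [integral_exp_neg_mul_log] at hlog
  have hint1 : IntegrableOn (fun x : ℝ => 2 * a * x * exp (-(a * x ^ 2))) (Set.Ioi 0) := by
    by_contra h
    rw [integral_undef h] at hone
    norm_num at hone
  have hint := integrableOn_mul_exp_mul_log ha le_rfl zero_le_one
  have hsplit : ∫ x in Set.Ioi (0 : ℝ), 2 * a * x * (exp (-(a * x ^ 2)) * log (a * x ^ 2)) =
      2 * (∫ x in Set.Ioi (0 : ℝ), 2 * a * x * exp (-a * x ^ 2) * log (x + √(0 ^ 2 + x ^ 2))) +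
        log (a / 4) * ∫ x in Set.Ioi (0 : ℝ), 2 * a * x * exp (-(a * x ^ 2)) := by
    rw [← integral_const_mul, ← integral_const_mul,
      ← integral_add (hint.const_mul 2) (hint1.const_mul _)]
    refine setIntegral_congr_fun measurableSet_Ioi fun x hx => ?_
    have hx : 0 < x := hx
    have h1 : log (a * x ^ 2) = 2 * log (2 * x) + log (a / 4) := by
      rw [show a * x ^ 2 = (2 * x) ^ 2 * (a / 4) by ring, log_mul (by positivity) (by positivity),
        log_pow]
      simp
    have h2 : x + √(0 ^ 2 + x ^ 2) = 2 * x := by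
      rw [zero_pow two_ne_zero, zero_add, sqrt_sq hx.le]; ring
    simp only [h1, h2, neg_mul]
    ring
  rw [hsplit, hone] at hlog
  linarith

lemma tendsto_integral_exp_div_sqrt_add_log {a : ℝ} (ha : 0 < a) :
    Tendsto (fun w : ℝ => (∫ x in Set.Ioi (0 : ℝ), exp (-a * x ^ 2) / √(w ^ 2 + x ^ 2)) + log w)
      (𝓝[>] 0) (𝓝 (-(1 / 2) * (log (a / 4) + eulerMascheroniConstant))) := by
  have hev : ∀ᶠ w : ℝ in 𝓝[>] 0, 0 < w ∧ w ≤ 1 :=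
    (Ioc_mem_nhdsGT one_pos : Set.Ioc (0 : ℝ) 1 ∈ 𝓝[>] 0)
  rw [← integral_mul_exp_mul_log_two_mul ha]
  have hlim : Tendsto (fun w : ℝ => ∫ x in Set.Ioi (0 : ℝ),
        2 * a * x * exp (-a * x ^ 2) * log (x + √(w ^ 2 + x ^ 2)))
      (𝓝[>] 0) (𝓝 (∫ x in Set.Ioi (0 : ℝ),
        2 * a * x * exp (-a * x ^ 2) * log (x + √(0 ^ 2 + x ^ 2)))) := by
    refine tendsto_integral_filter_of_dominated_convergence _
      (Eventually.of_forall fun w => aestronglyMeasurable_mul_exp_mul_log a w _) ?_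
      (integrableOn_quadratic_mul_exp_neg_mul_sq ha) ?_
    · filter_upwards [hev] with w hw
      exact (ae_restrict_iff' measurableSet_Ioi).2
        (ae_of_all _ fun _ hx => norm_mul_exp_mul_log_le ha hw.1.le hw.2 hx)
    · refine (ae_restrict_iff' measurableSet_Ioi).2 (ae_of_all _ fun x (hx : 0 < x) => ?_)
      have h0 : x + √(0 ^ 2 + x ^ 2) ≠ 0 := by positivity
      have : ContinuousAt
          (fun w : ℝ => 2 * a * x * exp (-a * x ^ 2) * log (x + √(w ^ 2 + x ^ 2))) 0 := by
        fun_prop (disch := assumption)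
      exact this.tendsto.mono_left nhdsWithin_le_nhds
  refine hlim.congr' ?_
  filter_upwards [hev] with w hw
  rw [integral_exp_div_sqrt ha hw.1 hw.2]
  ring

lemma norm_exp_mul_exp_sub_one_div_sqrt_le (a b w : ℝ) {x : ℝ} (hx : 0 < x) :
    ‖exp (-a * x ^ 2) * (exp (b * x) - 1) / √(w ^ 2 + x ^ 2)‖ ≤
      |b| * exp (-a * x ^ 2 + |b| * x) := by
  have hl : x ≤ √(w ^ 2 + x ^ 2) := le_sqrt_of_sq_le (by nlinarith [sq_nonneg w])
  have h := abs_exp_sub_one_le_mul_exp (b * x)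
  rw [abs_mul, abs_of_pos hx] at h
  rw [norm_div, norm_mul, norm_of_nonneg (exp_pos _).le, norm_of_nonneg (sqrt_nonneg _),
    norm_eq_abs, div_le_iff₀ (hx.trans_le hl), exp_add]
  calc exp (-a * x ^ 2) * |exp (b * x) - 1|
      ≤ exp (-a * x ^ 2) * (|b| * x * exp (|b| * x)) := by gcongr
    _ = |b| * (exp (-a * x ^ 2) * exp (|b| * x)) * x := by ring
    _ ≤ _ := by gcongr

lemma integrableOn_exp_mul_exp_sub_one_div_sqrt {a : ℝ} (ha : 0 < a) (b w : ℝ) :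
    IntegrableOn (fun x : ℝ => exp (-a * x ^ 2) * (exp (b * x) - 1) / √(w ^ 2 + x ^ 2))
      (Set.Ioi 0) :=
  (((integrable_exp_neg_mul_sq_add_mul ha |b|).const_mul |b|).integrableOn).mono'
    (by fun_prop : Measurable _).aestronglyMeasurable
    ((ae_restrict_iff' measurableSet_Ioi).2
      (ae_of_all _ fun _ hx => norm_exp_mul_exp_sub_one_div_sqrt_le a b w hx))

lemma tendsto_integral_exp_mul_exp_sub_one_div_sqrt {a : ℝ} (ha : 0 < a) (b : ℝ) :
    Tendsto (fun w : ℝ => ∫ x in Set.Ioi (0 : ℝ),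
        exp (-a * x ^ 2) * (exp (b * x) - 1) / √(w ^ 2 + x ^ 2))
      (𝓝[>] 0) (𝓝 (∫ x in Set.Ioi (0 : ℝ), exp (-a * x ^ 2) * (exp (b * x) - 1) / x)) := by
  refine tendsto_integral_filter_of_dominated_convergence _
    (Eventually.of_forall fun w => (by fun_prop : Measurable _).aestronglyMeasurable)
    (Eventually.of_forall fun w => (ae_restrict_iff' measurableSet_Ioi).2
      (ae_of_all _ fun _ hx => norm_exp_mul_exp_sub_one_div_sqrt_le a b w hx))
    ((integrable_exp_neg_mul_sq_add_mul ha |b|).const_mul |b|).integrableOn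
    ((ae_restrict_iff' measurableSet_Ioi).2 (ae_of_all _ fun x (hx : 0 < x) => ?_))
  have h0 : √(0 ^ 2 + x ^ 2) ≠ 0 := by positivity
  have : ContinuousAt
      (fun w : ℝ => exp (-a * x ^ 2) * (exp (b * x) - 1) / √(w ^ 2 + x ^ 2)) 0 := by
    fun_prop (disch := assumption)
  have h := this.tendsto.mono_left (nhdsWithin_le_nhds (s := Set.Ioi 0))
  rwa [zero_pow two_ne_zero, zero_add, sqrt_sq hx.le] at h

lemma hasSum_integral_exp_mul_exp_sub_one_div {a : ℝ} (ha : 0 < a) (b : ℝ) :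
    HasSum (fun m : ℕ => 1 / 2 * (Gamma (((m : ℝ) + 1) / 2) * b ^ (m + 1) /
        (Nat.factorial (m + 1) * a ^ (((m : ℝ) + 1) / 2))))
      (∫ x in Set.Ioi (0 : ℝ), exp (-a * x ^ 2) * (exp (b * x) - 1) / x) := by
  have hexp (y : ℝ) : HasSum (fun n : ℕ => y ^ n / n.factorial) (exp y) := by
    rw [exp_eq_exp_ℝ]
    exact NormedSpace.expSeries_div_hasSum_exp y
  have hbound (x : ℝ) : HasSum
      (fun m : ℕ => |b| ^ (m + 1) * x ^ m / m.factorial * exp (-a * x ^ 2))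
      (|b| * exp (-a * x ^ 2 + |b| * x)) := by
    convert! (hexp (|b| * x)).mul_left (|b| * exp (-a * x ^ 2)) using 1
    · ext m
      ring
    · rw [exp_add]
      ring
  have key := hasSum_integral_of_dominated_convergence
    (μ := volume.restrict (Set.Ioi (0 : ℝ)))
    (F := fun (m : ℕ) (x : ℝ) => b ^ (m + 1) / (m + 1).factorial * (x ^ m * exp (-a * x ^ 2)))
    (f := fun x => exp (-a * x ^ 2) * (exp (b * x) - 1) / x)
    (fun (m : ℕ) (x : ℝ) => |b| ^ (m + 1) * x ^ m / m.factorial * exp (-a * x ^ 2))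
    (fun m => (by fun_prop : Measurable _).aestronglyMeasurable)
    (fun m => (ae_restrict_iff' measurableSet_Ioi).2 (ae_of_all _ fun x (hx : 0 < x) => ?_))
    (ae_of_all _ fun x => (hbound x).summable)
    (by
      simp_rw [(hbound _).tsum_eq]
      exact ((integrable_exp_neg_mul_sq_add_mul ha |b|).const_mul |b|).integrableOn)
    ((ae_restrict_iff' measurableSet_Ioi).2 (ae_of_all _ fun x (hx : 0 < x) => ?_))
  · convert! key using 1
    ext m
    have h := integral_rpow_mul_exp_neg_mul_rpow (p := 2) (q := m) two_pos
      (by linarith [(Nat.cast_nonneg m : (0 : ℝ) ≤ m)]) ha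
    simp only [rpow_two, rpow_natCast] at h
    rw [integral_const_mul, h, neg_div, rpow_neg ha.le]
    have : a ^ (((m : ℝ) + 1) / 2) ≠ 0 := by positivity
    field_simp
  · have hfac : (m.factorial : ℝ) ≤ (m + 1).factorial := by
      exact_mod_cast Nat.factorial_le (Nat.le_succ m)
    rw [norm_mul, norm_div, norm_pow, norm_of_nonneg (by positivity : 0 ≤ x ^ m * exp (-a * x ^ 2)),
      norm_eq_abs, Real.norm_natCast]
    calc |b| ^ (m + 1) / (m + 1).factorial * (x ^ m * exp (-a * x ^ 2))
        ≤ |b| ^ (m + 1) / m.factorial * (x ^ m * exp (-a * x ^ 2)) := by gcongr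
      _ = _ := by ring
  · have h := ((hasSum_nat_add_iff' 1).2 (hexp (b * x))).mul_left (exp (-a * x ^ 2) / x)
    convert! h using 1
    · ext m
      field_simp
      ring
    · simp
      ring

/-- the small-`ω` leading behavior of
`∫₀^∞ e^{-αx²+βx}/√(ω²+x²) dx`: adding `ln ω`, the limit as `ω → 0⁺` is the
stated explicit constant, whose series converges absolutely. -/
theorem stmt_19 (α : ℝ) (hα : 0 < α) (β : ℝ) :
    Summable (fun m : ℕ => Real.Gamma (((m : ℝ) + 1) / 2) * β ^ (m + 1) /
      (Nat.factorial (m + 1) * α ^ (((m : ℝ) + 1) / 2))) ∧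
    Tendsto (fun ω : ℝ =>
        (∫ x in Set.Ioi (0 : ℝ), Real.exp (-α * x ^ 2 + β * x) /
          Real.sqrt (ω ^ 2 + x ^ 2)) + Real.log ω)
      (nhdsWithin 0 (Set.Ioi 0))
      (nhds (-(1 / 2) * (Real.log (α / 4) + Real.eulerMascheroniConstant) +
        (1 / 2) * ∑' m : ℕ, Real.Gamma (((m : ℝ) + 1) / 2) * β ^ (m + 1) /
          (Nat.factorial (m + 1) * α ^ (((m : ℝ) + 1) / 2)))) := by
  have hsum := hasSum_integral_exp_mul_exp_sub_one_div hα β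
  refine ⟨(summable_mul_left_iff (by norm_num : (1 / 2 : ℝ) ≠ 0)).1 hsum.summable, ?_⟩
  rw [← tsum_mul_left, hsum.tsum_eq]
  refine ((tendsto_integral_exp_div_sqrt_add_log hα).add
    (tendsto_integral_exp_mul_exp_sub_one_div_sqrt hα β)).congr' ?_
  filter_upwards [self_mem_nhdsWithin] with ω hω
  rw [add_right_comm, ← integral_add (integrable_exp_div_sqrt hα hω).integrableOn
    (integrableOn_exp_mul_exp_sub_one_div_sqrt hα β ω)]
  congr 1
  refine integral_congr_ae (ae_of_all _ fun x => ?_)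
  simp only [exp_add]
  ring
end
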